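/- arXiv:0904.3979 — 3 statements merged into one kernel-verified Lean document; each statement's English description precedes it below -/
import Mathlib

section
/- Let m ≥ 1 and n ≥ 0 be integers. Let σ be a permutation of P_{m+n+4} such that: σ(m+2) = m+3; σ(m+3) = m+4; σ(s) = m+2 for some integer s with 1 ≤ s ≤ m; σ(i) ≤ m for all integers i ≠ s with 1 ≤ i ≤ m+1; if n ≥ 1, then σ(j) ≥ m+5 for all integers j ≠ t with m+4 ≤ j ≤ m+4+n and σ(t) = m+1 for some integer t with m+5 ≤ t ≤ m+4+n; and if n = 0, then σ(m+4) = m+1. Let ρ be the permutation of P_{m+n+4} defined by: ρ(m+2) = m+1; ρ(m+3) = m+4; ρ(s) = m+3; ρ(t) = m+2 if n ≥ 1; ρ(m+4) = m+2 if n = 0; and ρ(i) = σ(i) for all other i. Then the Petrie matrices M_σ and M_ρ are similar over ℝ. -/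
open Matrix

/-- `σ` is a permutation of `P_n = {1,…,n}`, viewed as a function `ℕ → ℕ`. -/
def IsPermOn (n : ℕ) (σ : ℕ → ℕ) : Prop :=
  Set.BijOn σ (Set.Icc 1 n) (Set.Icc 1 n)

/-- The Petrie matrix of a map `σ` on `P_n`: the `(n-1) × (n-1)` real matrix whose
`(i,j)` entry (with `1`-based indices) is `1` iff
`min (σ i) (σ (i+1)) ≤ j ≤ max (σ i) (σ (i+1)) - 1`, and `0` otherwise. -/
def petrie (n : ℕ) (σ : ℕ → ℕ) : Matrix (Fin (n - 1)) (Fin (n - 1)) ℝ :=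
  Matrix.of fun i j =>
    if min (σ (i.1 + 1)) (σ (i.1 + 2)) ≤ j.1 + 1 ∧
        j.1 + 1 ≤ max (σ (i.1 + 1)) (σ (i.1 + 2)) - 1 then 1 else 0

/-- Two square real matrices are similar if `B = P * A * P⁻¹` for some invertible `P`. -/
def MatSimilar {m : Type*} [Fintype m] [DecidableEq m] (A B : Matrix m m ℝ) : Prop :=
  ∃ P : Matrix m m ℝ, IsUnit P ∧ B = P * A * P⁻¹

/-- `σ'` (a permutation of `P_{k+n}`) is a right extension of `σ` (a permutation of `P_k`). -/
def IsRightExt (k n : ℕ) (σ σ' : ℕ → ℕ) : Prop :=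
  IsPermOn (k + n) σ' ∧
  (∀ i, 1 ≤ i → i ≤ k - 1 → σ' i = σ i) ∧
  ∃ t, k + 1 ≤ t ∧ t ≤ k + n ∧ σ' t = σ k ∧
    ∀ j, j ≠ t → k ≤ j → j ≤ k + n → k < σ' j

/-- `(σ', ρ')` is a synchronized right extension of `(σ, ρ)` to `P_{k+n}`. -/
def IsSyncRightExt (k n : ℕ) (σ ρ σ' ρ' : ℕ → ℕ) : Prop :=
  IsRightExt k n σ σ' ∧ IsRightExt k n ρ ρ' ∧
  ∃ t, k + 1 ≤ t ∧ t ≤ k + n ∧ σ' t = σ k ∧ ρ' t = ρ k ∧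
    ∀ i, i ≠ t → k ≤ i → i ≤ k + n → σ' i = ρ' i

/-- `σ'` (a permutation of `P_{m+k}`) is a left extension of `σ` (a permutation of `P_k`). -/
def IsLeftExt (k m : ℕ) (σ σ' : ℕ → ℕ) : Prop :=
  IsPermOn (m + k) σ' ∧
  (∀ i, 2 ≤ i → i ≤ k → σ' (m + i) = m + σ i) ∧
  ∃ s, 1 ≤ s ∧ s ≤ m ∧ σ' s = m + σ 1 ∧
    ∀ j, j ≠ s → 1 ≤ j → j ≤ m + 1 → σ' j < m + 1

/-- `(σ', ρ')` is a synchronized left extension of `(σ, ρ)` to `P_{m+k}`. -/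
def IsSyncLeftExt (k m : ℕ) (σ ρ σ' ρ' : ℕ → ℕ) : Prop :=
  IsLeftExt k m σ σ' ∧ IsLeftExt k m ρ ρ' ∧
  ∃ s, 1 ≤ s ∧ s ≤ m ∧ σ' s = m + σ 1 ∧ ρ' s = m + ρ 1 ∧
    ∀ i, i ≠ s → 1 ≤ i → i ≤ m + 1 → σ' i = ρ' i

/-- `σ'` (a permutation of `P_{m+k+n}`) is a two-sided extension of `σ` (a permutation of `P_k`). -/
def IsTwoSidedExt (k m n : ℕ) (σ σ' : ℕ → ℕ) : Prop :=
  IsPermOn (m + k + n) σ' ∧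
  (∀ i, 2 ≤ i → i ≤ k - 1 → σ' (m + i) = m + σ i) ∧
  (∃ s, 1 ≤ s ∧ s ≤ m ∧ σ' s = m + σ 1 ∧
    ∀ i, i ≠ s → 1 ≤ i → i ≤ m + 1 → σ' i < m + 1) ∧
  (∃ t, m + k + 1 ≤ t ∧ t ≤ m + k + n ∧ σ' t = m + σ k ∧
    ∀ j, j ≠ t → m + k ≤ j → j ≤ m + k + n → m + k < σ' j)

/-- `(σ', ρ')` is a synchronized two-sided extension of `(σ, ρ)` to `P_{m+k+n}`. -/
def IsSyncTwoSidedExt (k m n : ℕ) (σ ρ σ' ρ' : ℕ → ℕ) : Prop :=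
  IsTwoSidedExt k m n σ σ' ∧ IsTwoSidedExt k m n ρ ρ' ∧
  ∃ s t, 1 ≤ s ∧ s ≤ m ∧ m + k + 1 ≤ t ∧ t ≤ m + k + n ∧
    σ' s = m + σ 1 ∧ ρ' s = m + ρ 1 ∧ σ' t = m + σ k ∧ ρ' t = m + ρ k ∧
    ∀ i, i ≠ s → i ≠ t →
      ((1 ≤ i ∧ i ≤ m + 1) ∨ (m + k ≤ i ∧ i ≤ m + k + n)) → σ' i = ρ' i

/-- `σ` and `ρ` (permutations of `P_k`) are right similar. -/
def RightSimilar (k : ℕ) (σ ρ : ℕ → ℕ) : Prop :=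
  ∀ n, 1 ≤ n → ∀ σ' ρ' : ℕ → ℕ, IsSyncRightExt k n σ ρ σ' ρ' →
    MatSimilar (petrie (k + n) σ') (petrie (k + n) ρ')

/-- `σ` and `ρ` (permutations of `P_k`) are left similar. -/
def LeftSimilar (k : ℕ) (σ ρ : ℕ → ℕ) : Prop :=
  ∀ m, 1 ≤ m → ∀ σ' ρ' : ℕ → ℕ, IsSyncLeftExt k m σ ρ σ' ρ' →
    MatSimilar (petrie (m + k) σ') (petrie (m + k) ρ')

/-- `σ` and `ρ` (permutations of `P_k`) are two-sided similar. -/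
def TwoSidedSimilar (k : ℕ) (σ ρ : ℕ → ℕ) : Prop :=
  ∀ m n, 1 ≤ m → 1 ≤ n → ∀ σ' ρ' : ℕ → ℕ, IsSyncTwoSidedExt k m n σ ρ σ' ρ' →
    MatSimilar (petrie (m + k + n) σ') (petrie (m + k + n) ρ')

/-- `σ` and `ρ` (permutations of `P_k`) are right weakly similar. -/
def RightWeaklySimilar (k : ℕ) (σ ρ : ℕ → ℕ) : Prop :=
  ∀ n, 1 ≤ n → ∀ σ' ρ' : ℕ → ℕ, IsSyncRightExt k n σ ρ σ' ρ' →
    (petrie (k + n) σ').charpoly = (petrie (k + n) ρ').charpoly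

/-- One-based entry of the Petrie matrix. -/
def pent (τ : ℕ → ℕ) (k j : ℕ) : ℝ :=
  if min (τ k) (τ (k + 1)) ≤ j ∧ j ≤ max (τ k) (τ (k + 1)) - 1 then 1 else 0

lemma sum_interval (N a b : ℕ) (ha : 1 ≤ a) (hb : b ≤ N) (g : ℕ → ℝ) :
    ∑ k : Fin (N - 1), (if a ≤ k.1 + 1 ∧ k.1 + 1 ≤ b - 1 then (1 : ℝ) else 0) * g (k.1 + 1)
      = ∑ k ∈ Finset.Ico a b, g k := by
  rw [Fin.sum_univ_eq_sum_range
    (fun k => (if a ≤ k + 1 ∧ k + 1 ≤ b - 1 then (1 : ℝ) else 0) * g (k + 1)) (N - 1)]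
  simp only [ite_mul, one_mul, zero_mul]
  rw [← Finset.sum_filter]
  refine Finset.sum_bij' (fun k _ => k + 1) (fun k _ => k - 1) ?_ ?_ ?_ ?_ ?_
  · intro k hk
    simp only [Finset.mem_filter, Finset.mem_range] at hk
    simp only [Finset.mem_Ico]; omega
  · intro k hk
    simp only [Finset.mem_Ico] at hk
    simp only [Finset.mem_filter, Finset.mem_range]; omega
  · intro k hk; simp
  · intro k hk
    simp only [Finset.mem_Ico] at hk
    omega
  · intro k hk; rfl

lemma petrie_mul_apply (N : ℕ) (ρ τ : ℕ → ℕ) (hρ : ∀ i, 1 ≤ i → i ≤ N → 1 ≤ ρ i ∧ ρ i ≤ N)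
    (i j : Fin (N - 1)) :
    (petrie N ρ * petrie N τ) i j =
      ∑ k ∈ Finset.Ico (min (ρ (i.1 + 1)) (ρ (i.1 + 2))) (max (ρ (i.1 + 1)) (ρ (i.1 + 2))),
        pent τ k (j.1 + 1) := by
  have hi := i.2
  have h1 := hρ (i.1 + 1) (by omega) (by omega)
  have h2 := hρ (i.1 + 2) (by omega) (by omega)
  rw [← sum_interval N _ _ (by omega) (by omega), Matrix.mul_apply]
  rfl

lemma petrie_isUnit (N : ℕ) (τ : ℕ → ℕ) (hτ : ∀ i, 1 ≤ i → i ≤ N → 1 ≤ τ i ∧ τ i ≤ N)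
    (hsurj : ∀ y, 1 ≤ y → y ≤ N → ∃ x, 1 ≤ x ∧ x ≤ N ∧ τ x = y) :
    IsUnit (petrie N τ) := by
  rw [← Matrix.mulVec_injective_iff_isUnit]
  rw [← Matrix.coe_mulVecLin, injective_iff_map_eq_zero]
  intro v hv
  rw [Matrix.mulVecLin_apply] at hv
  set g : ℕ → ℝ := fun k => if h : k - 1 < N - 1 then v ⟨k - 1, h⟩ else 0 with hg
  have hvg : ∀ k : Fin (N - 1), v k = g (k.1 + 1) := by
    intro k
    simp [hg]
  have hrow : ∀ i, 1 ≤ i → i + 1 ≤ N →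
      ∑ k ∈ Finset.range (τ i), g k = ∑ k ∈ Finset.range (τ (i + 1)), g k := by
    intro i hi hi'
    have h1 := hτ i hi (by omega)
    have h2 := hτ (i + 1) (by omega) hi'
    have h := congrFun hv ⟨i - 1, by omega⟩
    have h' : ∑ k ∈ Finset.Ico (min (τ i) (τ (i + 1))) (max (τ i) (τ (i + 1))), g k = 0 := by
      rw [← sum_interval N _ _ (by omega) (by omega)]
      rw [Pi.zero_apply] at h
      refine Eq.trans ?_ h
      simp only [Matrix.mulVec, dotProduct]
      refine Finset.sum_congr rfl fun k _ => ?_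
      rw [hvg k]
      simp only [petrie, Matrix.of_apply]
      rw [show i - 1 + 1 = i by omega, show i - 1 + 2 = i + 1 by omega]
    rw [Finset.sum_Ico_eq_sub _ (min_le_max)] at h'
    rcases le_total (τ i) (τ (i + 1)) with hle | hle
    · rw [max_eq_right hle, min_eq_left hle] at h'
      linarith
    · rw [max_eq_left hle, min_eq_right hle] at h'
      linarith
  have hconst : ∀ i, 1 ≤ i → i ≤ N →
      ∑ k ∈ Finset.range (τ i), g k = ∑ k ∈ Finset.range (τ 1), g k := by
    intro i hi
    induction i, hi using Nat.le_induction with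
    | base => intro _; rfl
    | succ i hi ih =>
      intro h
      rw [← hrow i hi h, ih (by omega)]
  have hF : ∀ y, 1 ≤ y → y ≤ N →
      ∑ k ∈ Finset.range y, g k = ∑ k ∈ Finset.range (τ 1), g k := by
    intro y h1 h2
    obtain ⟨x, hx1, hx2, rfl⟩ := hsurj y h1 h2
    exact hconst x hx1 hx2
  funext k
  have hk := k.2
  have e1 := hF (k.1 + 1) (by omega) (by omega)
  have e2 := hF (k.1 + 2) (by omega) (by omega)
  rw [Finset.sum_range_succ] at e2
  rw [hvg k, Pi.zero_apply]
  linarith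

/-- The auxiliary permutation whose Petrie matrix conjugates. -/
def auxPerm (m : ℕ) (σ : ℕ → ℕ) (k : ℕ) : ℕ :=
  if k ≤ m + 1 then σ k else if k = m + 2 then m + 1 else k

lemma sum_pent_id (m : ℕ) (σ : ℕ → ℕ) (a b j : ℕ) (ha : m + 3 ≤ a) :
    ∑ k ∈ Finset.Ico a b, pent (auxPerm m σ) k j = if a ≤ j ∧ j < b then 1 else 0 := by
  have : ∀ k ∈ Finset.Ico a b, pent (auxPerm m σ) k j = if j = k then 1 else 0 := by
    intro k hk
    rw [Finset.mem_Ico] at hk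
    have e1 : auxPerm m σ k = k := by unfold auxPerm; split_ifs <;> omega
    have e2 : auxPerm m σ (k + 1) = k + 1 := by unfold auxPerm; split_ifs <;> omega
    unfold pent
    rw [e1, e2]
    congr 1
    simp only [eq_iff_iff]; omega
  rw [Finset.sum_congr rfl this]
  simp

lemma ind_add (m a j : ℕ) (ha : a ≤ m) :
    (if min a (m + 1) ≤ j ∧ j ≤ max a (m + 1) - 1 then (1 : ℝ) else 0)
      + (if min (m + 1) (m + 2 + 1) ≤ j ∧ j ≤ max (m + 1) (m + 2 + 1) - 1 then 1 else 0)
      = if min a (m + 3) ≤ j ∧ j ≤ max a (m + 3) - 1 then 1 else 0 := by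
  rw [min_eq_left (by omega), max_eq_right (by omega), min_eq_left (by omega),
    max_eq_right (by omega), min_eq_left (by omega), max_eq_right (by omega)]
  split_ifs <;> first | omega | norm_num

lemma ind_add' (m y j : ℕ) (hy : m + 4 ≤ y) :
    (if min (m + 1) (m + 2 + 1) ≤ j ∧ j ≤ max (m + 1) (m + 2 + 1) - 1 then (1 : ℝ) else 0)
      + (if m + 2 + 1 ≤ j ∧ j < y then 1 else 0)
      = if m + 1 ≤ j ∧ j ≤ y - 1 then 1 else 0 := by
  rw [min_eq_left (by omega), max_eq_right (by omega)]
  split_ifs <;> first | omega | norm_num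

set_option maxHeartbeats 2000000 in
lemma key (m n : ℕ)
    (σ ρ : ℕ → ℕ) (hσ : ∀ i, 1 ≤ i → i ≤ m + n + 4 → 1 ≤ σ i ∧ σ i ≤ m + n + 4)
    (s t : ℕ) (hs1 : 1 ≤ s) (hs2 : s ≤ m)
    (h1 : σ (m + 2) = m + 3)
    (h2 : σ (m + 3) = m + 4)
    (h3 : σ s = m + 2)
    (h4 : ∀ i, i ≠ s → 1 ≤ i → i ≤ m + 1 → σ i ≤ m)
    (ht1 : m + 4 ≤ t) (ht2 : t ≤ m + 4 + n) (ht3 : σ t = m + 1)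
    (h5 : ∀ j, j ≠ t → m + 4 ≤ j → j ≤ m + 4 + n → m + 5 ≤ σ j)
    (r1 : ρ (m + 2) = m + 1)
    (r2 : ρ (m + 3) = m + 4)
    (r3 : ρ s = m + 3)
    (r4 : ρ t = m + 2)
    (r6 : ∀ i, 1 ≤ i → i ≤ m + n + 4 → i ≠ m + 2 → i ≠ m + 3 → i ≠ s → i ≠ t → ρ i = σ i)
    (i j : ℕ) (hi1 : 1 ≤ i) (hi2 : i + 1 ≤ m + n + 4) :
    ∑ k ∈ Finset.Ico (min (ρ i) (ρ (i + 1))) (max (ρ i) (ρ (i + 1))), pent (auxPerm m σ) k j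
    = ∑ k ∈ Finset.Ico (min (auxPerm m σ i) (auxPerm m σ (i + 1)))
        (max (auxPerm m σ i) (auxPerm m σ (i + 1))), pent σ k j := by
  have a0 : ∀ k, k ≤ m + 1 → auxPerm m σ k = σ k := fun k hk => if_pos hk
  have a1 : auxPerm m σ (m + 2) = m + 1 := by simp [auxPerm]
  have a2 : ∀ k, m + 3 ≤ k → auxPerm m σ k = k := by
    intro k hk; unfold auxPerm; split_ifs <;> omega
  have hm1 : σ (m + 1) ≤ m := h4 _ (by omega) (by omega) (by omega)
  have hagree : ∀ k, k ≤ m → pent (auxPerm m σ) k j = pent σ k j := by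
    intro k hk
    unfold pent; rw [a0 k (by omega), a0 (k + 1) (by omega)]
  have hab : pent (auxPerm m σ) (m + 1) j + pent (auxPerm m σ) (m + 2) j = pent σ (m + 1) j := by
    unfold pent
    rw [a0 (m + 1) le_rfl, a1, a2 (m + 2 + 1) (by omega), h1]
    exact ind_add m _ j hm1
  have hc : pent (auxPerm m σ) (m + 3) j = pent σ (m + 2) j := by
    unfold pent
    rw [a2 (m + 3) (by omega), a2 (m + 3 + 1) (by omega), h1, h2]
  have hagreeS : ∀ a b, b ≤ m + 1 → ∑ k ∈ Finset.Ico a b, pent (auxPerm m σ) k j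
      = ∑ k ∈ Finset.Ico a b, pent σ k j := by
    intro a b hb
    refine Finset.sum_congr rfl fun k hk => hagree k ?_
    rw [Finset.mem_Ico] at hk; omega
  have hlong : ∀ a, a ≤ m + 1 → ∑ k ∈ Finset.Ico a (m + 3), pent (auxPerm m σ) k j
      = ∑ k ∈ Finset.Ico a (m + 2), pent σ k j := by
    intro a ha
    rw [Finset.sum_Ico_succ_top (b := m + 2) (by omega),
      Finset.sum_Ico_succ_top (b := m + 1) (by omega),
      Finset.sum_Ico_succ_top (b := m + 1) (by omega), hagreeS _ _ le_rfl, ← hab]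
    ring
  have hρ0 : ∀ k, 1 ≤ k → k ≤ m + 1 → k ≠ s → ρ k = σ k := fun k _ _ _ =>
    r6 k (by omega) (by omega) (by omega) (by omega) (by omega) (by omega)
  have hρ1 : ∀ k, m + 4 ≤ k → k ≤ m + 4 + n → k ≠ t → ρ k = σ k := fun k _ _ _ =>
    r6 k (by omega) (by omega) (by omega) (by omega) (by omega) (by omega)
  have hbR : ∀ y, m + 4 ≤ y → ∑ k ∈ Finset.Ico (m + 2) y, pent (auxPerm m σ) k j
      = if m + 1 ≤ j ∧ j ≤ y - 1 then 1 else 0 := by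
    intro y hy
    rw [Finset.sum_eq_sum_Ico_succ_bot (by omega), sum_pent_id m σ _ _ _ (by omega)]
    unfold pent
    rw [a1, a2 (m + 2 + 1) (by omega)]
    exact ind_add' m y j hy
  rcases Nat.lt_or_ge m i with hi | hi
  · rcases eq_or_ne i (m + 1) with rfl | hne1
    · rw [r1, a1, a0 _ le_rfl, hρ0 _ (by omega) (by omega) (by omega)]
      exact hagreeS _ _ (by omega)
    rcases eq_or_ne i (m + 2) with rfl | hne2
    · rw [r1, r2, a1, a2 (m + 2 + 1) (by omega), min_eq_left (by omega), max_eq_right (by omega),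
        min_eq_left (by omega), max_eq_right (by omega), Finset.sum_Ico_succ_top (by omega),
        hlong _ le_rfl, Finset.sum_Ico_succ_top (b := m + 2) (by omega), hc]
    have hR : ∑ k ∈ Finset.Ico (min (auxPerm m σ i) (auxPerm m σ (i + 1)))
        (max (auxPerm m σ i) (auxPerm m σ (i + 1))), pent σ k j = pent σ i j := by
      rw [a2 i (by omega), a2 (i + 1) (by omega), min_eq_left (by omega), max_eq_right (by omega)]
      simp
    rw [hR]
    rcases eq_or_ne i (m + 3) with rfl | hne3
    · by_cases htt : m + 4 = t
      · subst htt
        rw [r2, r4, min_eq_right (by omega), max_eq_left (by omega), hbR _ le_rfl]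
        unfold pent
        rw [h2, ht3, min_eq_right (by omega), max_eq_left (by omega)]
      · have hh : m + 5 ≤ σ (m + 3 + 1) := h5 (m + 4) htt le_rfl (by omega)
        rw [r2, hρ1 (m + 3 + 1) (by omega) (by omega) (by omega), min_eq_left (by omega),
          max_eq_right (by omega), sum_pent_id _ _ _ _ _ (by omega)]
        unfold pent
        rw [h2, min_eq_left (by omega), max_eq_right (by omega)]
        congr 1; simp only [eq_iff_iff]; omega
    · by_cases hit : i = t
      · subst hit
        have hh := h5 (i + 1) (by omega) (by omega) (by omega)
        unfold pent
        rw [r4, ht3, hρ1 (i + 1) (by omega) (by omega) (by omega), min_eq_left (by omega),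
          max_eq_right (by omega), min_eq_left (by omega), max_eq_right (by omega)]
        exact hbR _ (by omega)
      · have hh := h5 i hit (by omega) (by omega)
        rw [hρ1 i (by omega) (by omega) hit]
        by_cases hit' : i + 1 = t
        · rw [hit', r4]
          unfold pent
          rw [hit', ht3, min_eq_right (by omega), max_eq_left (by omega),
            min_eq_right (by omega), max_eq_left (by omega)]
          exact hbR _ (by omega)
        · have hh' := h5 (i + 1) hit' (by omega) (by omega)
          rw [hρ1 (i + 1) (by omega) (by omega) hit', sum_pent_id _ _ _ _ _ (by omega)]
          unfold pent
          congr 1; simp only [eq_iff_iff]; omega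
  · rw [a0 i (by omega), a0 (i + 1) (by omega)]
    by_cases his : i = s
    · subst his
      have hh := h4 (i + 1) (by omega) (by omega) (by omega)
      rw [r3, h3, hρ0 (i + 1) (by omega) (by omega) (by omega), min_eq_right (by omega),
          max_eq_left (by omega), min_eq_right (by omega), max_eq_left (by omega)]
      exact hlong _ (by omega)
    · have hh := h4 i his (by omega) (by omega)
      rw [hρ0 i (by omega) (by omega) his]
      by_cases his' : i + 1 = s
      · rw [his', r3, h3, min_eq_left (by omega),
          max_eq_right (by omega), min_eq_left (by omega), max_eq_right (by omega)]
        exact hlong _ (by omega)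
      · have hh' := h4 (i + 1) his' (by omega) (by omega)
        rw [hρ0 (i + 1) (by omega) (by omega) his']
        exact hagreeS _ _ (by omega)

/-- Theorem 7. -/
theorem petrie_similar_of_swap (m n : ℕ) (hm : 1 ≤ m)
    (σ ρ : ℕ → ℕ) (hσ : IsPermOn (m + n + 4) σ) (hρ : IsPermOn (m + n + 4) ρ)
    (s t : ℕ) (hs1 : 1 ≤ s) (hs2 : s ≤ m)
    (h1 : σ (m + 2) = m + 3)
    (h2 : σ (m + 3) = m + 4)
    (h3 : σ s = m + 2)
    (h4 : ∀ i, i ≠ s → 1 ≤ i → i ≤ m + 1 → σ i ≤ m)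
    (h5 : 1 ≤ n → m + 5 ≤ t ∧ t ≤ m + 4 + n ∧ σ t = m + 1 ∧
      ∀ j, j ≠ t → m + 4 ≤ j → j ≤ m + 4 + n → m + 5 ≤ σ j)
    (h6 : n = 0 → σ (m + 4) = m + 1)
    (r1 : ρ (m + 2) = m + 1)
    (r2 : ρ (m + 3) = m + 4)
    (r3 : ρ s = m + 3)
    (r4 : 1 ≤ n → ρ t = m + 2)
    (r5 : n = 0 → ρ (m + 4) = m + 2)
    (r6 : ∀ i, 1 ≤ i → i ≤ m + n + 4 → i ≠ m + 2 → i ≠ m + 3 → i ≠ s →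
      (1 ≤ n → i ≠ t) → (n = 0 → i ≠ m + 4) → ρ i = σ i) :
    MatSimilar (petrie (m + n + 4) σ) (petrie (m + n + 4) ρ) := by
  obtain ⟨t', ht1, ht2, ht3, h5', r4', hr6'⟩ : ∃ t', m + 4 ≤ t' ∧ t' ≤ m + 4 + n ∧ σ t' = m + 1 ∧
      (∀ j, j ≠ t' → m + 4 ≤ j → j ≤ m + 4 + n → m + 5 ≤ σ j) ∧ ρ t' = m + 2 ∧
      (∀ i, 1 ≤ i → i ≤ m + n + 4 → i ≠ m + 2 → i ≠ m + 3 → i ≠ s → i ≠ t' → ρ i = σ i) := by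
    rcases Nat.eq_zero_or_pos n with hn | hn
    · refine ⟨m + 4, le_rfl, by omega, h6 hn, fun j _ _ _ => by omega, r5 hn, ?_⟩
      intro i a b c d e f
      exact r6 i a b c d e (fun h => by omega) (fun _ => f)
    · obtain ⟨p, q, r, u⟩ := h5 hn
      refine ⟨t, by omega, q, r, u, r4 hn, ?_⟩
      intro i a b c d e f
      exact r6 i a b c d e (fun _ => f) (fun h => by omega)
  have hσ' : ∀ i, 1 ≤ i → i ≤ m + n + 4 → 1 ≤ σ i ∧ σ i ≤ m + n + 4 :=
    fun i a b => hσ.mapsTo ⟨a, b⟩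
  have hρ' : ∀ i, 1 ≤ i → i ≤ m + n + 4 → 1 ≤ ρ i ∧ ρ i ≤ m + n + 4 :=
    fun i a b => hρ.mapsTo ⟨a, b⟩
  have hτ : ∀ i, 1 ≤ i → i ≤ m + n + 4 → 1 ≤ auxPerm m σ i ∧ auxPerm m σ i ≤ m + n + 4 := by
    intro i a b
    have := hσ' i a b
    unfold auxPerm
    split_ifs <;> omega
  have hunit : IsUnit (petrie (m + n + 4) (auxPerm m σ)) := by
    refine petrie_isUnit _ _ hτ ?_
    intro y hy1 hy2
    rcases Nat.lt_or_ge m y with hy | hy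
    · by_cases e1 : y = m + 1
      · exact ⟨m + 2, by omega, by omega, by simp [auxPerm, e1]⟩
      by_cases e2 : y = m + 2
      · refine ⟨s, by omega, by omega, ?_⟩
        unfold auxPerm
        rw [if_pos (by omega), h3, e2]
      · refine ⟨y, by omega, by omega, ?_⟩
        unfold auxPerm
        split_ifs <;> omega
    · obtain ⟨x, ⟨hx1, hx2⟩, hx⟩ := hσ.surjOn ⟨hy1, hy2⟩
      have hxm : x ≤ m + 1 := by
        by_contra hcon
        by_cases c1 : x = m + 2
        · subst c1; omega
        by_cases c2 : x = m + 3
        · subst c2; omega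
        by_cases c3 : x = t'
        · subst c3; omega
        have := h5' x c3 (by omega) (by omega)
        omega
      refine ⟨x, hx1, hx2, ?_⟩
      unfold auxPerm
      rw [if_pos hxm, hx]
  refine ⟨petrie (m + n + 4) (auxPerm m σ), hunit, ?_⟩
  have hcomm : petrie (m + n + 4) ρ * petrie (m + n + 4) (auxPerm m σ)
      = petrie (m + n + 4) (auxPerm m σ) * petrie (m + n + 4) σ := by
    ext i j
    rw [petrie_mul_apply _ _ _ hρ', petrie_mul_apply _ _ _ hτ]
    have hi := i.2
    exact key m n σ ρ hσ' s t' hs1 hs2 h1 h2 h3 h4 ht1 ht2 ht3 h5' r1 r2 r3 r4' hr6'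
      (i.1 + 1) (j.1 + 1) (by omega) (by omega)
  rw [← hcomm, Matrix.mul_assoc, Matrix.mul_nonsing_inv _ ((Matrix.isUnit_iff_isUnit_det _).1 hunit),
    Matrix.mul_one]
end

section
/- Let ℓ ≥ 4 and k ≥ ℓ+1 be integers. Let σ_ℓ, ρ_ℓ be permutations of P_ℓ with σ_ℓ(ℓ) = ℓ−1 and σ_ℓ(ℓ−1) < ℓ−1. Let ξ, η be permutations of {ℓ−1, ℓ, …, k} with ξ(ℓ) = ℓ−1, η(ℓ−1) = ℓ and η(ℓ) > ℓ. Define permutations of P_k by: (σξ)_k(x) = σ_ℓ(x) if 1 ≤ x ≤ ℓ−1 and σ_ℓ(x) ≠ ℓ, (σξ)_k(x) = ξ(ℓ−1) if 1 ≤ x ≤ ℓ−1 and σ_ℓ(x) = ℓ, and (σξ)_k(x) = ξ(x) if ℓ ≤ x ≤ k; (ση)_k(x) = σ_ℓ(x) if 1 ≤ x ≤ ℓ−1 and (ση)_k(x) = η(x) if ℓ ≤ x ≤ k; (ρη)_k(x) = ρ_ℓ(x) if 1 ≤ x ≤ ℓ−1, (ρη)_k(x) = η(x) if ℓ ≤ x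 ≤ k and η(x) ≠ ℓ−1, and (ρη)_k(x) = ρ_ℓ(ℓ) if ℓ ≤ x ≤ k and η(x) = ℓ−1. If σ_ℓ and ρ_ℓ are two-sided similar and the permutations of P_{k−ℓ+2} obtained from ξ and η by the shift x ↦ x−(ℓ−2) are two-sided similar, then (σξ)_k and (ση)_k are right similar and two-sided similar, and (ση)_k and (ρη)_k are left similar and two-sided similar. -/
open Matrix

/-- Assemble a synchronized two-sided extension. -/
theorem mk_sync {k m n : ℕ} {σ ρ σ' ρ' : ℕ → ℕ} (s t : ℕ)
    (hp : IsPermOn (m + k + n) σ') (hp' : IsPermOn (m + k + n) ρ')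
    (hmid : ∀ i, 2 ≤ i → i ≤ k - 1 → σ' (m + i) = m + σ i ∧ ρ' (m + i) = m + ρ i)
    (hs1 : 1 ≤ s) (hs2 : s ≤ m) (ht1 : m + k + 1 ≤ t) (ht2 : t ≤ m + k + n)
    (hs : σ' s = m + σ 1 ∧ ρ' s = m + ρ 1) (ht : σ' t = m + σ k ∧ ρ' t = m + ρ k)
    (hL : ∀ i, i ≠ s → 1 ≤ i → i ≤ m + 1 → σ' i < m + 1 ∧ σ' i = ρ' i)
    (hR : ∀ i, i ≠ t → m + k ≤ i → i ≤ m + k + n → m + k < σ' i ∧ σ' i = ρ' i) :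
    IsSyncTwoSidedExt k m n σ ρ σ' ρ' := by
  refine ⟨⟨hp, fun i h1 h2 => (hmid i h1 h2).1, ⟨s, hs1, hs2, hs.1, fun i h1 h2 h3 => (hL i h1 h2 h3).1⟩,
      ⟨t, ht1, ht2, ht.1, fun i h1 h2 h3 => (hR i h1 h2 h3).1⟩⟩,
    ⟨hp', fun i h1 h2 => (hmid i h1 h2).2, ⟨s, hs1, hs2, hs.2, fun i h1 h2 h3 => ?_⟩,
      ⟨t, ht1, ht2, ht.2, fun i h1 h2 h3 => ?_⟩⟩,
    s, t, hs1, hs2, ht1, ht2, hs.1, hs.2, ht.1, ht.2, ?_⟩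
  · have := hL i h1 h2 h3; omega
  · have := hR i h1 h2 h3; omega
  · rintro i h1 h2 (⟨h3, h4⟩ | ⟨h3, h4⟩)
    · exact (hL i h1 h3 h4).2
    · exact (hR i h2 h3 h4).2

theorem IsPermOn.inj {n : ℕ} {σ : ℕ → ℕ} (h : IsPermOn n σ) {i j : ℕ} (hi : 1 ≤ i) (hi' : i ≤ n)
    (hj : 1 ≤ j) (hj' : j ≤ n) (e : σ i = σ j) : i = j :=
  h.injOn ⟨hi, hi'⟩ ⟨hj, hj'⟩ e

theorem dest_sync {k m n : ℕ} {σ ρ σ' ρ' : ℕ → ℕ} (h : IsSyncTwoSidedExt k m n σ ρ σ' ρ')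
    (hk : 1 ≤ k) : ∃ s t, IsPermOn (m + k + n) σ' ∧ IsPermOn (m + k + n) ρ' ∧
    (∀ i, 2 ≤ i → i ≤ k - 1 → σ' (m + i) = m + σ i ∧ ρ' (m + i) = m + ρ i) ∧
    1 ≤ s ∧ s ≤ m ∧ m + k + 1 ≤ t ∧ t ≤ m + k + n ∧
    (σ' s = m + σ 1 ∧ ρ' s = m + ρ 1) ∧ (σ' t = m + σ k ∧ ρ' t = m + ρ k) ∧
    (∀ i, i ≠ s → 1 ≤ i → i ≤ m + 1 → σ' i < m + 1 ∧ σ' i = ρ' i) ∧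
    (∀ i, i ≠ t → m + k ≤ i → i ≤ m + k + n → m + k < σ' i ∧ σ' i = ρ' i) := by
  obtain ⟨⟨hp, hm, ⟨s1, a1, a2, a3, a4⟩, ⟨t1, b1, b2, b3, b4⟩⟩, ⟨hp', hm', -, -⟩,
    s, t, c1, c2, c3, c4, c5, c6, c7, c8, c9⟩ := h
  have es : s1 = s := hp.inj a1 (by omega) c1 (by omega) (by omega)
  have et : t1 = t := hp.inj (by omega) b2 (by omega) c4 (by omega)
  subst es et
  refine ⟨s1, t1, hp, hp', fun i h1 h2 => ⟨hm i h1 h2, hm' i h1 h2⟩, c1, c2, c3, c4, ⟨c5, c6⟩, ⟨c7, c8⟩,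
    fun i h1 h2 h3 => ⟨a4 i h1 h2 h3, c9 i h1 (by omega) (Or.inl ⟨h2, h3⟩)⟩,
    fun i h1 h2 h3 => ⟨b4 i h1 h2 h3, c9 i (by omega) h1 (Or.inr ⟨h2, h3⟩)⟩⟩

theorem matSimilar_cast {a b : ℕ} (e : a = b) {σ ρ : ℕ → ℕ}
    (h : MatSimilar (petrie a σ) (petrie a ρ)) : MatSimilar (petrie b σ) (petrie b ρ) := by
  subst e; exact h

/-- Theorem 4(b). -/
theorem combined_extensions_two_sided_similar
    (ℓ k : ℕ) (hl : 4 ≤ ℓ) (hk : ℓ + 1 ≤ k)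
    (σℓ ρℓ : ℕ → ℕ) (hσℓ : IsPermOn ℓ σℓ) (hρℓ : IsPermOn ℓ ρℓ)
    (hσl1 : σℓ ℓ = ℓ - 1) (hσl2 : σℓ (ℓ - 1) < ℓ - 1)
    (ξ η : ℕ → ℕ)
    (hξ : Set.BijOn ξ (Set.Icc (ℓ - 1) k) (Set.Icc (ℓ - 1) k))
    (hη : Set.BijOn η (Set.Icc (ℓ - 1) k) (Set.Icc (ℓ - 1) k))
    (hξ1 : ξ ℓ = ℓ - 1) (hη1 : η (ℓ - 1) = ℓ) (hη2 : ℓ < η ℓ)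
    (sx se re : ℕ → ℕ)
    (hsxP : IsPermOn k sx) (hseP : IsPermOn k se) (hreP : IsPermOn k re)
    (hsx1 : ∀ x, 1 ≤ x → x ≤ ℓ - 1 → σℓ x ≠ ℓ → sx x = σℓ x)
    (hsx2 : ∀ x, 1 ≤ x → x ≤ ℓ - 1 → σℓ x = ℓ → sx x = ξ (ℓ - 1))
    (hsx3 : ∀ x, ℓ ≤ x → x ≤ k → sx x = ξ x)
    (hse1 : ∀ x, 1 ≤ x → x ≤ ℓ - 1 → se x = σℓ x)
    (hse2 : ∀ x, ℓ ≤ x → x ≤ k → se x = η x)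
    (hre1 : ∀ x, 1 ≤ x → x ≤ ℓ - 1 → re x = ρℓ x)
    (hre2 : ∀ x, ℓ ≤ x → x ≤ k → η x ≠ ℓ - 1 → re x = η x)
    (hre3 : ∀ x, ℓ ≤ x → x ≤ k → η x = ℓ - 1 → re x = ρℓ ℓ)
    (hξη : TwoSidedSimilar (k - ℓ + 2)
      (fun x => ξ (x + (ℓ - 2)) - (ℓ - 2)) (fun x => η (x + (ℓ - 2)) - (ℓ - 2)))
    (hσρ : TwoSidedSimilar ℓ σℓ ρℓ) :
    (RightSimilar k sx se ∧ TwoSidedSimilar k sx se) ∧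
      (LeftSimilar k se re ∧ TwoSidedSimilar k se re) := by
  
  -- the position of the value `ℓ` in `σℓ`
  obtain ⟨a, ⟨ha1, ha2⟩, ha⟩ := hσℓ.surjOn (show ℓ ∈ Set.Icc 1 ℓ from ⟨by omega, le_refl _⟩)
  have ha3 : a ≤ ℓ - 2 := by
    have h1 : a ≠ ℓ := by rintro rfl; omega
    have h2 : a ≠ ℓ - 1 := by rintro rfl; omega
    omega
  have hσlt : ∀ i, i ≠ a → 1 ≤ i → i ≤ ℓ - 1 → σℓ i < ℓ - 1 := by
    intro i h1 h2 h3
    have h4 : σℓ i ≤ ℓ := (hσℓ.mapsTo (show i ∈ Set.Icc 1 ℓ from ⟨h2, by omega⟩)).2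
    have h5 : σℓ i ≠ ℓ := fun e => h1 (hσℓ.inj h2 (by omega) ha1 ha2 (by omega))
    have h6 : σℓ i ≠ ℓ - 1 := fun e => by
      have := hσℓ.inj h2 (by omega) (by omega : 1 ≤ ℓ) le_rfl (by omega)
      omega
    omega
  have hsxa : sx a = ξ (ℓ - 1) := hsx2 a ha1 (by omega) ha
  have hsea : se a = ℓ := by rw [hse1 a ha1 (by omega), ha]
  have hlow : ∀ i, i ≠ a → 1 ≤ i → i ≤ ℓ - 1 → sx i < ℓ - 1 ∧ sx i = se i := by
    intro i h1 h2 h3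
    have h4 := hσlt i h1 h2 h3
    rw [hse1 i h2 h3, hsx1 i h2 h3 (by omega)]
    exact ⟨h4, rfl⟩
  -- the position of the value `ℓ - 1` in `η`
  obtain ⟨b, ⟨hb1, hb2⟩, hb⟩ := hη.surjOn (show ℓ - 1 ∈ Set.Icc (ℓ - 1) k from ⟨le_refl _, by omega⟩)
  have hb3 : ℓ + 1 ≤ b := by
    have h1 : b ≠ ℓ := by rintro rfl; omega
    have h2 : b ≠ ℓ - 1 := by rintro rfl; omega
    omega
  have hηgt : ∀ i, i ≠ b → ℓ ≤ i → i ≤ k → ℓ < η i := by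
    intro i h1 h2 h3
    have h4 : ℓ - 1 ≤ η i := (hη.mapsTo (show i ∈ Set.Icc (ℓ - 1) k from ⟨by omega, h3⟩)).1
    have h5 : η i ≠ ℓ - 1 := fun e =>
      h1 (hη.injOn ⟨by omega, h3⟩ ⟨by omega, hb2⟩ (by omega))
    have h6 : η i ≠ ℓ := fun e => by
      have := hη.injOn (show i ∈ Set.Icc (ℓ - 1) k from ⟨by omega, h3⟩)
        (show ℓ - 1 ∈ Set.Icc (ℓ - 1) k from ⟨by omega, by omega⟩) (by omega)
      omega
    omega
  have hseb : se b = ℓ - 1 := by rw [hse2 b (by omega) hb2, hb]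
  have hreb : re b = ρℓ ℓ := hre3 b (by omega) hb2 hb
  have hhigh : ∀ i, i ≠ b → ℓ ≤ i → i ≤ k → ℓ < se i ∧ se i = re i := by
    intro i h1 h2 h3
    have h4 := hηgt i h1 h2 h3
    rw [hse2 i h2 h3, hre2 i h2 h3 (by omega)]
    exact ⟨h4, rfl⟩
  have hξge : ∀ i, ℓ - 1 ≤ i → i ≤ k → ℓ - 1 ≤ ξ i := fun i h1 h2 =>
    (hξ.mapsTo (show i ∈ Set.Icc (ℓ - 1) k from ⟨h1, h2⟩)).1
  have hηge : ∀ i, ℓ - 1 ≤ i → i ≤ k → ℓ - 1 ≤ η i := fun i h1 h2 =>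
    (hη.mapsTo (show i ∈ Set.Icc (ℓ - 1) k from ⟨h1, h2⟩)).1
  have eK : k - ℓ + 2 + (ℓ - 2) = k := by omega
  have e1 : 1 + (ℓ - 2) = ℓ - 1 := by omega
  have gξ1 := hξge (ℓ - 1) le_rfl (by omega)
  have gξk := hξge k (by omega) le_rfl
  have gηk := hηge k (by omega) le_rfl
  have vxk := hsx3 k (by omega) le_rfl
  have vek := hse2 k (by omega) le_rfl
  refine ⟨⟨?_, ?_⟩, ?_, ?_⟩
  · -- right similar
    rintro n hn σ' ρ' ⟨⟨hp, hm, t1, b1, b2, b3, b4⟩, ⟨hp', hm', -⟩, t, c1, c2, c3, c4, c5⟩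
    have et : t1 = t := hp.inj (by omega) b2 (by omega) c2 (by omega)
    subst et
    refine matSimilar_cast (a := (ℓ - 2) + (k - ℓ + 2) + n) (by omega)
      (hξη (ℓ - 2) n (by omega) hn σ' ρ' (mk_sync a t1 ?_ ?_ ?_ ha1 ha3 (by omega) (by omega) ?_ ?_ ?_ ?_))
    · convert hp using 1; omega
    · convert hp' using 1; omega
    · intro i h1 h2
      have g1 := hξge (i + (ℓ - 2)) (by omega) (by omega)
      have g2 := hηge (i + (ℓ - 2)) (by omega) (by omega)
      have v1 := hsx3 (i + (ℓ - 2)) (by omega) (by omega)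
      have v2 := hse2 (i + (ℓ - 2)) (by omega) (by omega)
      rw [add_comm (ℓ - 2) i, hm _ (by omega) (by omega), hm' _ (by omega) (by omega)]
      omega
    · rw [hm _ ha1 (by omega), hm' _ ha1 (by omega)]
      rw [e1]
      omega
    · rw [eK]
      omega
    · intro i h1 h2 h3
      have := hlow i h1 h2 (by omega)
      rw [hm _ h2 (by omega), hm' _ h2 (by omega)]
      omega
    · intro i h1 h2 h3
      have g1 := b4 i h1 (by omega) (by omega)
      have g2 := c5 i h1 (by omega) (by omega)
      omega
  · -- two-sided similar
    intro m n hm0 hn σ' ρ' h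
    obtain ⟨s, t, hp, hp', hm, s1, s2, t1, t2, vs, vt, hL, hR⟩ := dest_sync h (by omega)
    -- new left position
    obtain ⟨s', q1, q2, q3, q4⟩ : ∃ s', 1 ≤ s' ∧ s' ≤ m + (ℓ - 2) ∧
        (σ' s' = m + sx a ∧ ρ' s' = m + se a) ∧
        ∀ i, i ≠ s' → 1 ≤ i → i ≤ m + (ℓ - 1) → σ' i < m + (ℓ - 1) ∧ σ' i = ρ' i := by
      by_cases h1 : a = 1
      · refine ⟨s, s1, by omega, h1 ▸ vs, fun i g1 g2 g3 => ?_⟩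
        by_cases h4 : i ≤ m + 1
        · have := hL i g1 g2 h4
          omega
        · obtain ⟨j, rfl⟩ : ∃ j, i = m + j := ⟨i - m, by omega⟩
          have u1 := hm j (by omega) (by omega)
          have u2 := hlow j (by omega) (by omega) (by omega)
          omega
      · refine ⟨m + a, by omega, by omega, hm a (by omega) (by omega), fun i g1 g2 g3 => ?_⟩
        by_cases h5 : i = s
        · have := hlow 1 (by omega) le_rfl (by omega)
          rw [h5]
          omega
        by_cases h4 : i ≤ m + 1
        · have := hL i h5 g2 h4
          omega
        · obtain ⟨j, rfl⟩ : ∃ j, i = m + j := ⟨i - m, by omega⟩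
          have u1 := hm j (by omega) (by omega)
          have u2 := hlow j (by omega) (by omega) (by omega)
          omega
    refine matSimilar_cast (a := (m + (ℓ - 2)) + (k - ℓ + 2) + n) (by omega)
      (hξη (m + (ℓ - 2)) n (by omega) hn σ' ρ'
        (mk_sync s' t ?_ ?_ ?_ q1 q2 (by omega) (by omega) ?_ ?_ ?_ ?_))
    · convert hp using 1; omega
    · convert hp' using 1; omega
    · intro i h1 h2
      have g1 := hξge (i + (ℓ - 2)) (by omega) (by omega)
      have g2 := hηge (i + (ℓ - 2)) (by omega) (by omega)
      have v1 := hsx3 (i + (ℓ - 2)) (by omega) (by omega)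
      have v2 := hse2 (i + (ℓ - 2)) (by omega) (by omega)
      have v3 := hm (i + (ℓ - 2)) (by omega) (by omega)
      rw [show m + (ℓ - 2) + i = m + (i + (ℓ - 2)) by omega]
      omega
    · rw [e1]
      omega
    · rw [eK]
      omega
    · intro i h1 h2 h3
      have := q4 i h1 h2 (by omega)
      omega
    · intro i h1 h2 h3
      have := hR i h1 (by omega) (by omega)
      omega
  · -- left similar
    rintro m hm0 σ' ρ' ⟨⟨hp, hm, s1, b1, b2, b3, b4⟩, ⟨hp', hm', -⟩, s, c1, c2, c3, c4, c5⟩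
    have es : s1 = s := hp.inj b1 (by omega) c1 (by omega) (by omega)
    subst es
    have w1 := hse1 1 le_rfl (by omega)
    have w2 := hre1 1 le_rfl (by omega)
    refine matSimilar_cast (a := m + ℓ + (k - ℓ)) (by omega)
      (hσρ m (k - ℓ) hm0 (by omega) σ' ρ'
        (mk_sync s1 (m + b) ?_ ?_ ?_ b1 b2 (by omega) (by omega) ?_ ?_ ?_ ?_))
    · convert hp using 1; omega
    · convert hp' using 1; omega
    · intro i h1 h2
      rw [hm i h1 (by omega), hm' i h1 (by omega), hse1 i (by omega) h2, hre1 i (by omega) h2]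
      exact ⟨rfl, rfl⟩
    · omega
    · rw [hm b (by omega) hb2, hm' b (by omega) hb2]
      omega
    · intro i h1 h2 h3
      exact ⟨b4 i h1 h2 h3, c5 i h1 h2 h3⟩
    · intro i h1 h2 h3
      obtain ⟨j, rfl⟩ : ∃ j, i = m + j := ⟨i - m, by omega⟩
      have u1 := hm j (by omega) (by omega)
      have u3 := hm' j (by omega) (by omega)
      have u2 := hhigh j (by omega) (by omega) (by omega)
      omega
  · -- two-sided similar
    intro m n hm0 hn σ' ρ' h
    obtain ⟨s, t, hp, hp', hm, s1, s2, t1, t2, vs, vt, hL, hR⟩ := dest_sync h (by omega)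
    have w1 := hse1 1 le_rfl (by omega)
    have w2 := hre1 1 le_rfl (by omega)
    -- new right position
    obtain ⟨t', q1, q2, q3, q4⟩ : ∃ t', m + ℓ + 1 ≤ t' ∧ t' ≤ m + k + n ∧
        (σ' t' = m + se b ∧ ρ' t' = m + re b) ∧
        ∀ i, i ≠ t' → m + ℓ ≤ i → i ≤ m + k + n → m + ℓ < σ' i ∧ σ' i = ρ' i := by
      by_cases h1 : b = k
      · refine ⟨t, by omega, t2, h1 ▸ vt, fun i g1 g2 g3 => ?_⟩
        by_cases h4 : m + k ≤ i
        · have := hR i g1 h4 g3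
          omega
        · obtain ⟨j, rfl⟩ : ∃ j, i = m + j := ⟨i - m, by omega⟩
          have u1 := hm j (by omega) (by omega)
          have u2 := hhigh j (by omega) (by omega) (by omega)
          omega
      · refine ⟨m + b, by omega, by omega, hm b (by omega) (by omega), fun i g1 g2 g3 => ?_⟩
        by_cases h5 : i = t
        · have := hhigh k (by omega) (by omega) le_rfl
          rw [h5]
          omega
        by_cases h4 : m + k ≤ i
        · have := hR i h5 h4 g3
          omega
        · obtain ⟨j, rfl⟩ : ∃ j, i = m + j := ⟨i - m, by omega⟩
          have u1 := hm j (by omega) (by omega)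
          have u2 := hhigh j (by omega) (by omega) (by omega)
          omega
    refine matSimilar_cast (a := m + ℓ + (k - ℓ + n)) (by omega)
      (hσρ m (k - ℓ + n) hm0 (by omega) σ' ρ'
        (mk_sync s t' ?_ ?_ ?_ s1 s2 (by omega) (by omega) ?_ ?_ hL ?_))
    · convert hp using 1; omega
    · convert hp' using 1; omega
    · intro i h1 h2
      have v3 := hm i h1 (by omega)
      rw [hse1 i (by omega) h2, hre1 i (by omega) h2] at v3
      exact v3
    · omega
    · omega
    · intro i h1 h2 h3
      exact q4 i h1 h2 (by omega)
end

section
/- Let k ≥ 5 be an integer. For each 3 ≤ n ≤ k−1, let σ_{n,k} be the cyclic permutation of P_k defined by σ_{n,k}(1) = n, σ_{n,k}(i) = i+1 for n ≤ i ≤ k−1, σ_{n,k}(k) = n−1, and σ_{n,k}(j) = j−1 for 2 ≤ j ≤ n−1. Then all the σ_{n,k}, 3 ≤ n ≤ k−1, are right similar, left similar, and two-sided similar to one another, and moreover the Petrie matrices M_{σ_{n,k}}, 3 ≤ n ≤ k−1, are pairwise similar over ℝ. -/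
open Matrix

/-- The cyclic permutation `σ_{n,k}` of `P_k`:
`σ_{n,k}(1) = n`, `σ_{n,k}(i) = i+1` for `n ≤ i ≤ k-1`, `σ_{n,k}(k) = n-1`,
and `σ_{n,k}(j) = j-1` for `2 ≤ j ≤ n-1`.
(For `n = 2` this is `1→2→⋯→k→1`; for `n = k` this is `1→k→k-1→⋯→2→1`.) -/
def sigmaNK (n k : ℕ) : ℕ → ℕ := fun i =>
  if i = 1 then n
  else if n ≤ i ∧ i ≤ k - 1 then i + 1
  else if i = k then n - 1
  else if 2 ≤ i ∧ i ≤ n - 1 then i - 1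
  else i

/-! ### Similarity is an equivalence relation -/

lemma MatSimilar.refl' {m : Type*} [Fintype m] [DecidableEq m] (A : Matrix m m ℝ) :
    MatSimilar A A := ⟨1, isUnit_one, by simp⟩

lemma matSimilar_of_intertwine {m : Type*} [Fintype m] [DecidableEq m] {A B P : Matrix m m ℝ}
    (hP : IsUnit P) (h : A * P = P * B) : MatSimilar A B := by
  have hd : IsUnit P.det := (Matrix.isUnit_iff_isUnit_det P).1 hP
  refine ⟨P⁻¹, (Matrix.isUnit_nonsing_inv_iff).2 hP, ?_⟩
  rw [Matrix.nonsing_inv_nonsing_inv P hd, Matrix.mul_assoc, h, ← Matrix.mul_assoc,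
    Matrix.nonsing_inv_mul P hd, Matrix.one_mul]

lemma MatSimilar.symm' {m : Type*} [Fintype m] [DecidableEq m] {A B : Matrix m m ℝ}
    (h : MatSimilar A B) : MatSimilar B A := by
  obtain ⟨P, hP, rfl⟩ := h
  have hd : IsUnit P.det := (Matrix.isUnit_iff_isUnit_det P).1 hP
  refine matSimilar_of_intertwine hP ?_
  rw [Matrix.mul_assoc, Matrix.nonsing_inv_mul P hd, Matrix.mul_one]

lemma MatSimilar.trans' {m : Type*} [Fintype m] [DecidableEq m] {A B C : Matrix m m ℝ}
    (h : MatSimilar A B) (h' : MatSimilar B C) : MatSimilar A C := by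
  obtain ⟨P, hP, rfl⟩ := h
  obtain ⟨Q, hQ, rfl⟩ := h'
  refine ⟨Q * P, hQ.mul hP, ?_⟩
  rw [Matrix.mul_inv_rev]
  simp only [Matrix.mul_assoc]

/-! ### Potentials and the Petrie operator on functions -/

/-- Partial sums of an edge function. -/
def potS (x : ℕ → ℝ) (p : ℕ) : ℝ := ∑ j ∈ Finset.Ico 1 p, x j

/-- The Petrie operator on edge functions. -/
def petT (σ : ℕ → ℕ) (x : ℕ → ℝ) (i : ℕ) : ℝ :=
  potS x (max (σ i) (σ (i + 1))) - potS x (min (σ i) (σ (i + 1)))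

/-- The intertwiner on edge functions. -/
def intF (c : ℕ) (ρ : ℕ → ℕ) (x : ℕ → ℝ) (i : ℕ) : ℝ :=
  if i < c then x i else if i = c then x c + x (c + 1)
  else if i = c + 1 then x (c + 2) else petT ρ x i

/-- Extension of a vector by zero. -/
def extE (K : ℕ) (v : Fin (K - 1) → ℝ) (j : ℕ) : ℝ :=
  if h : 1 ≤ j ∧ j < K then v ⟨j - 1, by omega⟩ else 0

lemma potS_succ (x : ℕ → ℝ) {p : ℕ} (hp : 1 ≤ p) : potS x (p + 1) = potS x p + x p := by
  unfold potS
  rw [Finset.sum_Ico_succ_top hp]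

lemma potS_congr {x y : ℕ → ℝ} {p : ℕ} (h : ∀ j, 1 ≤ j → j < p → x j = y j) :
    potS x p = potS y p := by
  unfold potS
  refine Finset.sum_congr rfl fun j hj => ?_
  rw [Finset.mem_Ico] at hj
  exact h j hj.1 hj.2

lemma potS_add (x y : ℕ → ℝ) (p : ℕ) : potS (x + y) p = potS x p + potS y p := by
  simp [potS, Finset.sum_add_distrib]

lemma potS_smul (a : ℝ) (x : ℕ → ℝ) (p : ℕ) : potS (a • x) p = a * potS x p := by
  simp [potS, Finset.mul_sum]

lemma petT_add (σ : ℕ → ℕ) (x y : ℕ → ℝ) (i : ℕ) :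
    petT σ (x + y) i = petT σ x i + petT σ y i := by
  simp only [petT, potS_add]; ring

lemma petT_smul (σ : ℕ → ℕ) (a : ℝ) (x : ℕ → ℝ) (i : ℕ) :
    petT σ (a • x) i = a * petT σ x i := by
  simp only [petT, potS_smul]; ring

lemma intF_add (c : ℕ) (σ : ℕ → ℕ) (x y : ℕ → ℝ) (i : ℕ) :
    intF c σ (x + y) i = intF c σ x i + intF c σ y i := by
  simp only [intF, petT_add]; split_ifs <;> simp <;> ring

lemma intF_smul (c : ℕ) (σ : ℕ → ℕ) (a : ℝ) (x : ℕ → ℝ) (i : ℕ) :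
    intF c σ (a • x) i = a * intF c σ x i := by
  simp only [intF, petT_smul]; split_ifs <;> simp <;> ring

lemma extE_add (K : ℕ) (v w : Fin (K - 1) → ℝ) : extE K (v + w) = extE K v + extE K w := by
  funext j; simp only [extE, Pi.add_apply]; split_ifs <;> simp

lemma extE_smul (K : ℕ) (a : ℝ) (v : Fin (K - 1) → ℝ) : extE K (a • v) = a • extE K v := by
  funext j; simp only [extE, Pi.smul_apply]; split_ifs <;> simp

lemma extE_succ (K : ℕ) (v : Fin (K - 1) → ℝ) (i : Fin (K - 1)) : extE K v (i.1 + 1) = v i := by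
  have := i.2
  unfold extE
  rw [dif_pos (by omega)]
  rfl

lemma extE_eq {K : ℕ} {v : Fin (K - 1) → ℝ} {f : ℕ → ℝ}
    (h : ∀ i : Fin (K - 1), v i = f (i.1 + 1)) {j : ℕ} (h1 : 1 ≤ j) (h2 : j < K) :
    extE K v j = f j := by
  unfold extE
  rw [dif_pos ⟨h1, h2⟩, h]
  congr 1
  simp only
  omega

lemma petT_congr {K : ℕ} {σ : ℕ → ℕ} (hσ : ∀ i, 1 ≤ i → i ≤ K → σ i ≤ K) {x y : ℕ → ℝ}
    (h : ∀ j, 1 ≤ j → j < K → x j = y j) {i : ℕ} (h1 : 1 ≤ i) (h2 : i < K) :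
    petT σ x i = petT σ y i := by
  have a := hσ i h1 h2.le
  have b := hσ (i + 1) (by omega) h2
  unfold petT
  rw [potS_congr (x := x) (y := y) fun j hj hj' => h j hj (by omega),
    potS_congr (x := x) (y := y) fun j hj hj' => h j hj (by omega)]

lemma intF_congr {K c : ℕ} {σ : ℕ → ℕ} (hσ : ∀ i, 1 ≤ i → i ≤ K → σ i ≤ K) (hc : 1 ≤ c)
    (hcK : c + 3 ≤ K) {x y : ℕ → ℝ}
    (h : ∀ j, 1 ≤ j → j < K → x j = y j) {i : ℕ} (h1 : 1 ≤ i) (h2 : i < K) :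
    intF c σ x i = intF c σ y i := by
  unfold intF
  rw [h i h1 h2, h c (by omega) (by omega), h (c + 1) (by omega) (by omega),
    h (c + 2) (by omega) (by omega), petT_congr hσ h h1 h2]

lemma petrie_mulVec {K : ℕ} {σ : ℕ → ℕ} (hσ : ∀ i, 1 ≤ i → i ≤ K → 1 ≤ σ i ∧ σ i ≤ K)
    (v : Fin (K - 1) → ℝ) (i : Fin (K - 1)) :
    (petrie K σ *ᵥ v) i = petT σ (extE K v) (i.1 + 1) := by
  have hi := i.2
  have a := hσ (i.1 + 1) (by omega) (by omega)
  have b := hσ (i.1 + 2) (by omega) (by omega)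
  set p := min (σ (i.1 + 1)) (σ (i.1 + 2)) with hp
  set q := max (σ (i.1 + 1)) (σ (i.1 + 2)) with hq
  have hpq : p ≤ q := by omega
  have hp1 : 1 ≤ p := by omega
  have hqK : q ≤ K := by omega
  have e1 : petT σ (extE K v) (i.1 + 1) = ∑ j ∈ Finset.Ico p q, extE K v j := by
    unfold petT potS
    rw [show i.1 + 1 + 1 = i.1 + 2 from rfl, ← hp, ← hq,
      ← Finset.sum_Ico_consecutive _ hp1 hpq]
    ring
  have e2 : (petrie K σ *ᵥ v) i =
      ∑ j : Fin (K - 1), (fun j : ℕ => if p ≤ j + 1 ∧ j + 1 ≤ q - 1 then extE K v (j + 1) else 0) j.1 := by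
    simp only [Matrix.mulVec, dotProduct, petrie, Matrix.of_apply]
    refine Finset.sum_congr rfl fun j _ => ?_
    rw [extE_succ, ← hp, ← hq]
    split_ifs <;> simp
  rw [e1, e2, Fin.sum_univ_eq_sum_range
    (fun j : ℕ => if p ≤ j + 1 ∧ j + 1 ≤ q - 1 then extE K v (j + 1) else 0),
    ← Finset.sum_filter]
  refine Finset.sum_bij' (fun j _ => j + 1) (fun j _ => j - 1) ?_ ?_ ?_ ?_ ?_
  · intro j hj; simp at hj ⊢; omega
  · intro j hj; simp at hj ⊢; omega
  · intro j hj; simp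
  · intro j hj; simp at hj ⊢; omega
  · intro j hj; rfl

/-! ### The abstract one-step lemma -/

/-- The configuration of two consecutive members of the family. -/
structure StepData (K c s t : ℕ) (σ ρ : ℕ → ℕ) : Prop where
  hc : 2 ≤ c
  hcK : c + 3 ≤ K
  hs1 : 1 ≤ s
  hsc : s < c
  htc : c + 3 ≤ t
  htK : t ≤ K
  σs : σ s = c + 1
  ρs : ρ s = c + 2
  σt : σ t = c
  ρt : ρ t = c + 1
  left : ∀ p, 1 ≤ p → p ≤ c → p ≠ s → σ p = ρ p ∧ 1 ≤ ρ p ∧ ρ p < c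
  right : ∀ p, c + 2 ≤ p → p ≤ K → p ≠ t → σ p = ρ p ∧ c + 3 ≤ ρ p ∧ ρ p ≤ K
  σc : σ c = c - 1
  σc1 : σ (c + 1) = c + 2
  ρc1 : ρ (c + 1) = c
  ρc2 : ρ (c + 2) = c + 3
  surj : ∀ v, 1 ≤ v → v ≤ K → ∃ i, 1 ≤ i ∧ i ≤ K ∧ ρ i = v

lemma StepData.bddρ {K c s t : ℕ} {σ ρ : ℕ → ℕ} (h : StepData K c s t σ ρ) (i : ℕ)
    (h1 : 1 ≤ i) (h2 : i ≤ K) : 1 ≤ ρ i ∧ ρ i ≤ K := by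
  obtain ⟨hc, hcK, hs1, hsc, htc, htK, σs, ρs, σt, ρt, left, right, σc, σc1, ρc1, ρc2, -⟩ := h
  by_cases a : i = s
  · subst a; omega
  by_cases b : i = t
  · subst b; omega
  by_cases d : i = c + 1
  · subst d; omega
  by_cases e : i ≤ c
  · have := left i h1 e a; omega
  · have := right i (by omega) h2 b; omega

lemma StepData.bddσ {K c s t : ℕ} {σ ρ : ℕ → ℕ} (h : StepData K c s t σ ρ) (i : ℕ)
    (h1 : 1 ≤ i) (h2 : i ≤ K) : 1 ≤ σ i ∧ σ i ≤ K := by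
  obtain ⟨hc, hcK, hs1, hsc, htc, htK, σs, ρs, σt, ρt, left, right, σc, σc1, ρc1, ρc2, -⟩ := h
  by_cases a : i = s
  · subst a; omega
  by_cases b : i = t
  · subst b; omega
  by_cases d : i = c + 1
  · subst d; omega
  by_cases e : i ≤ c
  · have := left i h1 e a; omega
  · have := right i (by omega) h2 b; omega

lemma petT_of_le {σ : ℕ → ℕ} (x : ℕ → ℝ) {i a b : ℕ} (ha : σ i = a) (hb : σ (i + 1) = b)
    (h : a ≤ b) : petT σ x i = potS x b - potS x a := by
  unfold petT; rw [ha, hb, max_eq_right h, min_eq_left h]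

lemma petT_of_ge {σ : ℕ → ℕ} (x : ℕ → ℝ) {i a b : ℕ} (ha : σ i = a) (hb : σ (i + 1) = b)
    (h : b ≤ a) : petT σ x i = potS x a - potS x b := by
  unfold petT; rw [ha, hb, max_eq_left h, min_eq_right h]

lemma potS_intF_le (c : ℕ) (ρ : ℕ → ℕ) (x : ℕ → ℝ) {p : ℕ} (hp : p ≤ c) :
    potS (intF c ρ x) p = potS x p :=
  potS_congr fun j _ hj' => by unfold intF; rw [if_pos (by omega)]

lemma potS_intF_c1 {c : ℕ} (hc : 1 ≤ c) (ρ : ℕ → ℕ) (x : ℕ → ℝ) :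
    potS (intF c ρ x) (c + 1) = potS x (c + 2) := by
  rw [potS_succ _ hc, potS_intF_le c ρ x le_rfl, potS_succ x (p := c + 1) (by omega),
    potS_succ x hc]
  simp [intF]; ring

lemma potS_intF_c2 {c : ℕ} (hc : 1 ≤ c) (ρ : ℕ → ℕ) (x : ℕ → ℝ) :
    potS (intF c ρ x) (c + 2) = potS x (c + 3) := by
  rw [potS_succ _ (p := c + 1) (by omega), potS_intF_c1 hc, potS_succ x (p := c + 2) (by omega)]
  simp [intF]

lemma potS_intF_ge {c : ℕ} (ρ : ℕ → ℕ) (x : ℕ → ℝ) {p : ℕ} (hp : c + 2 ≤ p) :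
    potS (intF c ρ x) p - potS (petT ρ x) p =
      potS (intF c ρ x) (c + 2) - potS (petT ρ x) (c + 2) := by
  induction p, hp using Nat.le_induction with
  | base => rfl
  | succ p hp ih =>
    rw [potS_succ _ (by omega), potS_succ _ (by omega), ← ih]
    have : intF c ρ x p = petT ρ x p := by
      unfold intF
      rw [if_neg (by omega), if_neg (by omega), if_neg (by omega)]
    rw [this]; ring

/-- `z_{c+1} = x_c + x_{c+1} + x_{c+2}`, in potential form. -/
lemma StepData.petc1 {K c s t : ℕ} {σ ρ : ℕ → ℕ} (h : StepData K c s t σ ρ) (x : ℕ → ℝ) :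
    petT ρ x (c + 1) = potS x (c + 3) - potS x c :=
  petT_of_le x h.ρc1 h.ρc2 (by omega)

lemma StepData.intertwine {K c s t : ℕ} {σ ρ : ℕ → ℕ} (h : StepData K c s t σ ρ) (x : ℕ → ℝ)
    {i : ℕ} (h1 : 1 ≤ i) (h2 : i < K) :
    petT σ (intF c ρ x) i = intF c ρ (petT ρ x) i := by
  have hz := h.petc1 x
  obtain ⟨hc, hcK, hs1, hsc, htc, htK, σs, ρs, σt, ρt, left, right, σc, σc1, ρc1, ρc2, -⟩ := h
  have yc1 := potS_intF_c1 (c := c) (by omega) ρ x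
  have yc2 := potS_intF_c2 (c := c) (by omega) ρ x
  rcases lt_or_ge i c with hi | hi
  · -- left part
    have er : intF c ρ (petT ρ x) i = petT ρ x i := by unfold intF; rw [if_pos hi]
    rw [er]
    by_cases a : i = s
    · subst a
      have q := left (i + 1) (by omega) (by omega) (by omega)
      rw [petT_of_ge _ σs q.1 (by omega), petT_of_ge _ ρs rfl (by omega), yc1,
        potS_intF_le c ρ x (by omega)]
    have q := left i (by omega) (by omega) a
    by_cases b : i + 1 = s
    · subst b
      rw [petT_of_le _ q.1 σs (by omega), petT_of_le _ rfl ρs (by omega), yc1,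
        potS_intF_le c ρ x (by omega)]
    have q' := left (i + 1) (by omega) (by omega) b
    unfold petT
    rw [q.1, q'.1, potS_intF_le c ρ x (by omega), potS_intF_le c ρ x (by omega)]
  rcases eq_or_lt_of_le hi with hi | hi
  · subst hi
    have q := left c (by omega) le_rfl (by omega)
    have er : intF c ρ (petT ρ x) c = petT ρ x c + petT ρ x (c + 1) := by simp [intF]
    rw [er, petT_of_le _ σc σc1 (by omega), yc2, hz, potS_intF_le c ρ x (by omega),
      petT_of_le x (q.1.symm.trans σc) ρc1 (by omega)]
    ring
  rcases eq_or_lt_of_le (Nat.succ_le_of_lt hi) with hi | hi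
  · rw [Nat.succ_eq_add_one] at hi
    subst hi
    have q := right (c + 2) le_rfl (by omega) (by omega)
    have er : intF c ρ (petT ρ x) (c + 1) = petT ρ x (c + 2) := by simp [intF]
    rw [er, petT_of_le _ σc1 (q.1.trans ρc2) (by omega),
      potS_succ (intF c ρ x) (p := c + 2) (by omega)]
    simp [intF]
  · have er : intF c ρ (petT ρ x) i = petT ρ (petT ρ x) i := by
      unfold intF; rw [if_neg (by omega), if_neg (by omega), if_neg (by omega)]
    rw [er]
    have zc2 := potS_succ (petT ρ x) (p := c + 1) (by omega)
    have yc := potS_intF_le c ρ x (p := c) le_rfl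
    have key : ∀ p, c + 2 ≤ p → potS (intF c ρ x) p - potS (intF c ρ x) c =
        potS (petT ρ x) p - potS (petT ρ x) (c + 1) := by
      intro p hp
      have := potS_intF_ge ρ x hp
      rw [show c + 1 + 1 = c + 2 from rfl] at zc2
      linarith
    by_cases a : i = t
    · subst a
      have q := right (i + 1) (by omega) (by omega) (by omega)
      rw [petT_of_le _ σt q.1 (by omega), petT_of_le _ ρt rfl (by omega), key _ (by omega)]
    have q := right i (by omega) (by omega) a
    by_cases b : i + 1 = t
    · subst b
      rw [petT_of_ge _ q.1 σt (by omega), petT_of_ge _ rfl ρt (by omega), key _ (by omega)]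
    have q' := right (i + 1) (by omega) (by omega) b
    unfold petT
    rw [q.1, q'.1]
    have k1 := key (max (ρ i) (ρ (i + 1))) (by omega)
    have k2 := key (min (ρ i) (ρ (i + 1))) (by omega)
    unfold petT at k1 k2
    linarith

/-- The Petrie operator of a surjection is injective. -/
lemma petT_inj {K : ℕ} {ρ : ℕ → ℕ} 
    (surj : ∀ v, 1 ≤ v → v ≤ K → ∃ i, 1 ≤ i ∧ i ≤ K ∧ ρ i = v) (x : ℕ → ℝ)
    (h : ∀ i, 1 ≤ i → i < K → petT ρ x i = 0) (i : ℕ) (h1 : 1 ≤ i) (h2 : i < K) : x i = 0 := by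
  have key : ∀ i, 1 ≤ i → i ≤ K → potS x (ρ i) = potS x (ρ 1) := by
    intro i h1
    induction i, h1 using Nat.le_induction with
    | base => intro _; rfl
    | succ i h1 ih =>
      intro h2
      rw [← ih (by omega)]
      have := h i h1 (by omega)
      rcases le_total (ρ i) (ρ (i + 1)) with hh | hh
      · rw [petT_of_le x rfl rfl hh] at this; linarith
      · rw [petT_of_ge x rfl rfl hh] at this; linarith
  obtain ⟨a, a1, a2, a3⟩ := surj i h1 h2.le
  obtain ⟨b, b1, b2, b3⟩ := surj (i + 1) (by omega) h2
  have e1 := key a a1 a2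
  have e2 := key b b1 b2
  rw [a3] at e1
  rw [b3, potS_succ x h1] at e2
  linarith

lemma StepData.inj {K c s t : ℕ} {σ ρ : ℕ → ℕ} (h : StepData K c s t σ ρ) (x : ℕ → ℝ)
    (hx : ∀ i, 1 ≤ i → i < K → intF c ρ x i = 0) (i : ℕ) (h1 : 1 ≤ i) (h2 : i < K) :
    x i = 0 := by
  refine petT_inj h.surj x ?_ i h1 h2
  clear h1 h2 i
  intro i h1 h2
  have hz := h.petc1 x
  obtain ⟨hc, hcK, hs1, hsc, htc, htK, σs, ρs, σt, ρt, left, right, σc, σc1, ρc1, ρc2, -⟩ := h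
  have x0 : ∀ p, p ≤ c → potS x p = 0 := by
    intro p hp
    have : potS x p = potS (fun _ => 0) p := potS_congr fun j hj hj' => by
      have := hx j hj (by omega)
      unfold intF at this
      rwa [if_pos (by omega)] at this
    rw [this]; simp [potS]
  have y0 : ∀ p, p ≤ K → potS (intF c ρ x) p = 0 := by
    intro p hp
    have : potS (intF c ρ x) p = potS (fun _ => 0) p :=
      potS_congr fun j hj hj' => hx j hj (by omega)
    rw [this]; simp [potS]
  have x2 : potS x (c + 2) = 0 := by
    rw [← potS_intF_c1 (c := c) (by omega) ρ x]; exact y0 _ (by omega)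
  have x3 : potS x (c + 3) = 0 := by
    rw [← potS_intF_c2 (c := c) (by omega) ρ x]; exact y0 _ (by omega)
  have lv : ∀ p, 1 ≤ p → p ≤ c + 1 → potS x (ρ p) = 0 := by
    intro p hp hp'
    by_cases a : p = s
    · subst a; rw [ρs, x2]
    by_cases b : p = c + 1
    · subst b; rw [ρc1]; exact x0 c le_rfl
    · have := left p hp (by omega) a
      exact x0 _ (by omega)
  rcases lt_or_ge i (c + 1) with hi | hi
  · have q1 := lv i h1 (by omega)
    have q2 := lv (i + 1) (by omega) (by omega)
    rcases le_total (ρ i) (ρ (i + 1)) with hh | hh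
    · rw [petT_of_le x rfl rfl hh]; linarith
    · rw [petT_of_ge x rfl rfl hh]; linarith
  rcases eq_or_lt_of_le hi with hi | hi
  · subst hi
    rw [hz, x3, x0 c le_rfl, sub_zero]
  · have := hx i h1 h2
    unfold intF at this
    rwa [if_neg (by omega), if_neg (by omega), if_neg (by omega)] at this

/-- The intertwiner as a linear map. -/
def intL (K c : ℕ) (ρ : ℕ → ℕ) : (Fin (K - 1) → ℝ) →ₗ[ℝ] (Fin (K - 1) → ℝ) where
  toFun v i := intF c ρ (extE K v) (i.1 + 1)
  map_add' v w := by funext i; simp only [extE_add, intF_add, Pi.add_apply]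
  map_smul' a v := by
    funext i; simp only [extE_smul, intF_smul, Pi.smul_apply, smul_eq_mul, RingHom.id_apply]

lemma StepData.similar {K c s t : ℕ} {σ ρ : ℕ → ℕ} (h : StepData K c s t σ ρ) :
    MatSimilar (petrie K σ) (petrie K ρ) := by
  have hc := h.hc
  have hcK := h.hcK
  have hm : ∀ v, LinearMap.toMatrix' (intL K c ρ) *ᵥ v = intL K c ρ v := fun v => by
    rw [LinearMap.toMatrix'_mulVec]
  refine matSimilar_of_intertwine (P := LinearMap.toMatrix' (intL K c ρ)) ?_ ?_
  · rw [← Matrix.mulVec_injective_iff_isUnit]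
    intro v w hvw
    have hvw' : intL K c ρ v = intL K c ρ w := by rw [← hm, ← hm]; exact hvw
    rw [← sub_eq_zero, ← map_sub] at hvw'
    rw [← sub_eq_zero]
    funext i
    have hi := i.2
    rw [← extE_succ K (v - w) i]
    refine h.inj _ ?_ _ (by omega) (by omega)
    intro j h1 h2
    have := congrFun hvw' ⟨j - 1, by omega⟩
    simp only [intL, LinearMap.coe_mk, AddHom.coe_mk, Pi.zero_apply] at this
    rwa [show j - 1 + 1 = j by omega] at this
  · refine Matrix.ext_of_mulVec_single fun j => ?_
    generalize (Pi.single j 1 : Fin (K - 1) → ℝ) = v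
    rw [← Matrix.mulVec_mulVec, ← Matrix.mulVec_mulVec, hm, hm]
    funext i
    have hi := i.2
    rw [petrie_mulVec h.bddσ]
    have e1 : petT σ (extE K (intL K c ρ v)) (i.1 + 1) =
        petT σ (intF c ρ (extE K v)) (i.1 + 1) :=
      petT_congr (K := K) (fun i a b => (h.bddσ i a b).2)
        (fun j a b => extE_eq (f := intF c ρ (extE K v)) (fun i => rfl) a b)
        (Nat.succ_le_succ (Nat.zero_le _)) (by omega)
    rw [e1, h.intertwine _ (by omega) (by omega)]
    change _ = intF c ρ (extE K (petrie K ρ *ᵥ v)) (i.1 + 1)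
    refine intF_congr (K := K) (i := i.1 + 1) (fun i a b => (h.bddρ i a b).2) (by omega) hcK ?_
      (by omega) (by omega)
    intro j a b
    exact (extE_eq (fun i => petrie_mulVec h.bddρ v i) a b).symm

/-! ### The family of extensions -/

/-- The extension of `sigmaNK n k` with outer data `g`. -/
def tauE (m k s t : ℕ) (g : ℕ → ℕ) (n : ℕ) (i : ℕ) : ℕ :=
  if i = s then m + n else if i = t then m + n - 1
  else if m + 2 ≤ i ∧ i ≤ m + k - 1 then (if i < m + n then i - 1 else i + 1) else g i

/-- Admissible outer data. -/
structure GoodBase (m k K s t : ℕ) (g : ℕ → ℕ) : Prop where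
  hs1 : 1 ≤ s
  hsm : s ≤ m + 1
  htk : m + k ≤ t
  htK : t ≤ K
  left : ∀ i, 1 ≤ i → i ≤ m + 1 → i ≠ s → 1 ≤ g i ∧ g i ≤ m
  right : ∀ i, m + k ≤ i → i ≤ K → i ≠ t → m + k < g i ∧ g i ≤ K
  surj : ∀ v, 1 ≤ v → v ≤ K → (v ≤ m ∨ m + k < v) →
    ∃ i, 1 ≤ i ∧ i ≤ K ∧ (i ≤ m + 1 ∨ m + k ≤ i) ∧ i ≠ s ∧ i ≠ t ∧ g i = v

lemma GoodBase.step {m k K s t : ℕ} {g : ℕ → ℕ} (h : GoodBase m k K s t g) {n : ℕ}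
    (h3 : 3 ≤ n) (hn : n + 1 ≤ k - 1) :
    MatSimilar (petrie K (tauE m k s t g n)) (petrie K (tauE m k s t g (n + 1))) := by
  obtain ⟨hs1, hsm, htk, htK, left, right, surj⟩ := h
  refine StepData.similar (c := m + n - 1) (s := s) (t := t) ⟨by omega, by omega, hs1, by omega,
    by omega, htK, ?_, ?_, ?_, ?_, ?_, ?_, ?_, ?_, ?_, ?_, ?_⟩
  · unfold tauE; split_ifs <;> omega
  · unfold tauE; split_ifs <;> omega
  · unfold tauE; split_ifs <;> omega
  · unfold tauE; split_ifs <;> omega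
  · intro p h1 h2 hp
    have := left p h1
    unfold tauE; split_ifs <;> omega
  · intro p h1 h2 hp
    have := right p
    unfold tauE; split_ifs <;> omega
  · unfold tauE; split_ifs <;> omega
  · unfold tauE; split_ifs <;> omega
  · unfold tauE; split_ifs <;> omega
  · unfold tauE; split_ifs <;> omega
  · intro v h1 h2
    by_cases a : v ≤ m ∨ m + k < v
    · obtain ⟨i, i1, i2, i3, i4, i5, i6⟩ := surj v h1 h2 a
      refine ⟨i, i1, i2, ?_⟩
      unfold tauE; split_ifs <;> omega
    by_cases b : v = m + n + 1
    · refine ⟨s, by omega, by omega, ?_⟩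
      unfold tauE; split_ifs <;> omega
    by_cases d : v = m + n
    · refine ⟨t, by omega, by omega, ?_⟩
      unfold tauE; split_ifs <;> omega
    by_cases e : v < m + n
    · refine ⟨v + 1, by omega, by omega, ?_⟩
      unfold tauE; split_ifs <;> omega
    · refine ⟨v - 1, by omega, by omega, ?_⟩
      unfold tauE; split_ifs <;> omega

lemma GoodBase.le_similar {m k K s t : ℕ} {g : ℕ → ℕ} (h : GoodBase m k K s t g) {n₁ n₂ : ℕ}
    (h3 : 3 ≤ n₁) (h12 : n₁ ≤ n₂) (hn : n₂ ≤ k - 1) :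
    MatSimilar (petrie K (tauE m k s t g n₁)) (petrie K (tauE m k s t g n₂)) := by
  induction n₂, h12 using Nat.le_induction with
  | base => exact MatSimilar.refl' _
  | succ n hn' ih => exact (ih (by omega)).trans' (h.step (by omega) hn)

lemma petrie_congr {K : ℕ} {σ ρ : ℕ → ℕ} (h : ∀ i, 1 ≤ i → i ≤ K → σ i = ρ i) :
    petrie K σ = petrie K ρ := by
  ext i j
  have := i.2
  simp only [petrie, Matrix.of_apply]
  rw [h (i.1 + 1) (by omega) (by omega), h (i.1 + 2) (by omega) (by omega)]

/-- The uniform statement covering the four cases. -/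
lemma GoodBase.main {m k K s t : ℕ} {g : ℕ → ℕ} (h : GoodBase m k K s t g) {n₁ n₂ : ℕ}
    (h₁ : 3 ≤ n₁) (h₁' : n₁ ≤ k - 1) (h₂ : 3 ≤ n₂) (h₂' : n₂ ≤ k - 1) {σ ρ : ℕ → ℕ}
    (hσ : ∀ i, 1 ≤ i → i ≤ K → σ i = tauE m k s t g n₁ i)
    (hρ : ∀ i, 1 ≤ i → i ≤ K → ρ i = tauE m k s t g n₂ i) :
    MatSimilar (petrie K σ) (petrie K ρ) := by
  rw [petrie_congr hσ, petrie_congr hρ]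
  rcases le_total n₁ n₂ with a | a
  · exact h.le_similar h₁ a h₂'
  · exact (h.le_similar h₂ a h₁').symm'

lemma goodBase_of_perm {m k K s t n : ℕ} {g : ℕ → ℕ} (h₁ : 3 ≤ n) (h₁' : n ≤ k - 1)
    (hs1 : 1 ≤ s) (hsm : s ≤ m + 1) (htk : m + k ≤ t) (htK : t ≤ K) (hp : IsPermOn K g)
    (left : ∀ i, 1 ≤ i → i ≤ m + 1 → i ≠ s → g i ≤ m)
    (right : ∀ i, m + k ≤ i → i ≤ K → i ≠ t → m + k < g i)
    (hg : ∀ i, 1 ≤ i → i ≤ K → g i = tauE m k s t g n i) : GoodBase m k K s t g := by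
  have bd : ∀ i, 1 ≤ i → i ≤ K → 1 ≤ g i ∧ g i ≤ K := fun i a b => hp.mapsTo ⟨a, b⟩
  refine ⟨hs1, hsm, htk, htK, fun i a b d => ⟨(bd i a (by omega)).1, left i a b d⟩,
    fun i a b d => ⟨right i a b d, (bd i (by omega) b).2⟩, ?_⟩
  intro v v1 v2 v3
  obtain ⟨i, ⟨i1, i2⟩, rfl⟩ := hp.surjOn (Set.mem_Icc.2 ⟨v1, v2⟩)
  have e := hg i i1 i2
  refine ⟨i, i1, i2, ?_, ?_, ?_, rfl⟩
  all_goals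
    unfold tauE at e
    split_ifs at e <;> omega

lemma sigmaNK_mid {k m s t : ℕ} {g : ℕ → ℕ} (hs : s ≤ m + 1) (ht : m + k ≤ t) {n i : ℕ}
    (h : 3 ≤ n) (h' : n ≤ k - 1) (h1 : m + 2 ≤ i) (h2 : i ≤ m + k - 1) :
    m + sigmaNK n k (i - m) = tauE m k s t g n i := by
  unfold tauE sigmaNK
  split_ifs <;> omega

lemma sigmaNK_one (n k : ℕ) : sigmaNK n k 1 = n := by simp [sigmaNK]

lemma sigmaNK_last {n k : ℕ} (h : 3 ≤ n) (h' : n ≤ k - 1) : sigmaNK n k k = n - 1 := by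
  unfold sigmaNK; split_ifs <;> omega

/-- Agreement with `tauE` from agreement on the three parts. -/
lemma eq_tauE {k m s t K n : ℕ} {g f : ℕ → ℕ} (hs : s ≤ m + 1) (ht : m + k ≤ t)
    (h : 3 ≤ n) (h' : n ≤ k - 1) (fs : f s = m + n) (ft : f t = m + (n - 1))
    (mid : ∀ i, 2 ≤ i → i ≤ k - 1 → f (m + i) = m + sigmaNK n k i)
    (out : ∀ i, 1 ≤ i → i ≤ K → i ≠ s → i ≠ t → (i ≤ m + 1 ∨ m + k ≤ i) → f i = g i) :
    ∀ i, 1 ≤ i → i ≤ K → f i = tauE m k s t g n i := by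
  intro i i1 i2
  by_cases hi : m + 2 ≤ i ∧ i ≤ m + k - 1
  · have := mid (i - m) (by omega) (by omega)
    rw [show m + (i - m) = i by omega] at this
    rw [this, sigmaNK_mid hs ht h h' hi.1 hi.2]
  · unfold tauE
    rw [if_neg hi]
    by_cases a : i = s
    · rw [if_pos a, a, fs]
    by_cases b : i = t
    · rw [if_neg a, if_pos b, b, ft]; omega
    rw [if_neg a, if_neg b]
    exact out i i1 i2 a b (by omega)

/-- Theorem 8(1). -/
theorem sigmaNK_all_similar (k : ℕ) (hk : 5 ≤ k) (n₁ n₂ : ℕ)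
    (h₁ : 3 ≤ n₁) (h₁' : n₁ ≤ k - 1) (h₂ : 3 ≤ n₂) (h₂' : n₂ ≤ k - 1) :
    RightSimilar k (sigmaNK n₁ k) (sigmaNK n₂ k) ∧
    LeftSimilar k (sigmaNK n₁ k) (sigmaNK n₂ k) ∧
    TwoSidedSimilar k (sigmaNK n₁ k) (sigmaNK n₂ k) ∧
    MatSimilar (petrie k (sigmaNK n₁ k)) (petrie k (sigmaNK n₂ k)) := by
  refine ⟨?_, ?_, ?_, ?_⟩
  · rintro n hn σ' ρ' ⟨⟨pσ, iσ, tσ, a1, a2, a3, a4⟩, ⟨pρ, iρ, -⟩, t, t1, t2, t3, t4, t5⟩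
    have ht : tσ = t := pσ.injOn ⟨by omega, a2⟩ ⟨by omega, t2⟩ (a3.trans t3.symm)
    subst ht
    rw [sigmaNK_last h₁ h₁'] at t3
    rw [sigmaNK_last h₂ h₂'] at t4
    have s3 := iσ 1 le_rfl (by omega)
    have s4 := iρ 1 le_rfl (by omega)
    rw [sigmaNK_one] at s3 s4
    have hσ : ∀ i, 1 ≤ i → i ≤ k + n → σ' i = tauE 0 k 1 tσ σ' n₁ i :=
      eq_tauE (by omega) (by omega) h₁ h₁' (by omega) (by omega)
        (fun i a b => by rw [zero_add, zero_add]; exact iσ i (by omega) b)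
        (fun i _ _ _ _ _ => rfl)
    have hρ : ∀ i, 1 ≤ i → i ≤ k + n → ρ' i = tauE 0 k 1 tσ σ' n₂ i :=
      eq_tauE (by omega) (by omega) h₂ h₂' (by omega) (by omega)
        (fun i a b => by rw [zero_add, zero_add]; exact iρ i (by omega) b)
        (fun i a b d e f => (t5 i e (by omega) b).symm)
    exact (goodBase_of_perm h₁ h₁' (by omega) (by omega) (by omega) t2 pσ
      (fun i a b d => by omega) (fun i a b d => by have := a4 i d (by omega) b; omega) hσ).main
      h₁ h₁' h₂ h₂' hσ hρ
  · rintro m hm σ' ρ' ⟨⟨pσ, iσ, sσ, a1, a2, a3, a4⟩, ⟨pρ, iρ, -⟩, s, t1, t2, t3, t4, t5⟩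
    have ht : sσ = s := pσ.injOn ⟨by omega, by omega⟩ ⟨by omega, by omega⟩ (a3.trans t3.symm)
    subst ht
    rw [sigmaNK_one] at t3 t4
    have s3 := iσ k (by omega) le_rfl
    have s4 := iρ k (by omega) le_rfl
    rw [sigmaNK_last h₁ h₁'] at s3
    rw [sigmaNK_last h₂ h₂'] at s4
    have hσ : ∀ i, 1 ≤ i → i ≤ m + k → σ' i = tauE m k sσ (m + k) σ' n₁ i :=
      eq_tauE (by omega) (by omega) h₁ h₁' (by omega) (by omega)
        (fun i a b => iσ i (by omega) (by omega)) (fun i _ _ _ _ _ => rfl)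
    have hρ : ∀ i, 1 ≤ i → i ≤ m + k → ρ' i = tauE m k sσ (m + k) σ' n₂ i :=
      eq_tauE (by omega) (by omega) h₂ h₂' (by omega) (by omega)
        (fun i a b => iρ i (by omega) (by omega))
        (fun i a b d e f => (t5 i d (by omega) (by omega)).symm)
    exact (goodBase_of_perm h₁ h₁' (by omega) (by omega) (by omega) le_rfl pσ
      (fun i a b d => by have := a4 i d a b; omega) (fun i a b d => by omega) hσ).main
      h₁ h₁' h₂ h₂' hσ hρ
  · rintro m n hm hn σ' ρ' ⟨⟨pσ, iσ, ⟨sσ, b1, b2, b3, b4⟩, tσ, a1, a2, a3, a4⟩, ⟨pρ, iρ, -⟩,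
      s, t, s1, s2, t1, t2, s3, s4, t3, t4, t5⟩
    have hs : sσ = s := pσ.injOn ⟨by omega, by omega⟩ ⟨by omega, by omega⟩ (b3.trans s3.symm)
    subst hs
    have ht : tσ = t := pσ.injOn ⟨by omega, by omega⟩ ⟨by omega, by omega⟩ (a3.trans t3.symm)
    subst ht
    rw [sigmaNK_one] at s3 s4
    rw [sigmaNK_last h₁ h₁'] at t3
    rw [sigmaNK_last h₂ h₂'] at t4
    have hσ : ∀ i, 1 ≤ i → i ≤ m + k + n → σ' i = tauE m k sσ tσ σ' n₁ i :=
      eq_tauE (by omega) (by omega) h₁ h₁' s3 t3 iσ (fun i _ _ _ _ _ => rfl)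
    have hρ : ∀ i, 1 ≤ i → i ≤ m + k + n → ρ' i = tauE m k sσ tσ σ' n₂ i :=
      eq_tauE (by omega) (by omega) h₂ h₂' s4 t4 iρ
        (fun i a b d e f => (t5 i d e (by omega)).symm)
    exact (goodBase_of_perm h₁ h₁' (by omega) (by omega) (by omega) t2 pσ
      (fun i a b d => by have := b4 i d a b; omega)
      (fun i a b d => by have := a4 i d a b; omega) hσ).main
      h₁ h₁' h₂ h₂' hσ hρ
  · have hb : GoodBase 0 k k 1 k id := ⟨by omega, by omega, by omega, by omega,
      fun i _ _ _ => by omega, fun i _ _ _ => by omega, fun v _ _ _ => by omega⟩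
    have e : ∀ n, 3 ≤ n → n ≤ k - 1 → ∀ i, 1 ≤ i → i ≤ k →
        sigmaNK n k i = tauE 0 k 1 k id n i := by
      intro n _ _ i _ _
      unfold tauE sigmaNK
      split_ifs <;> first | omega | (simp; omega)
    exact hb.main h₁ h₁' h₂ h₂' (e _ h₁ h₁') (e _ h₂ h₂')
end
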